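/- arXiv:1204.4626 — 5 statements merged into one kernel-verified Lean document; each statement's English description precedes it below -/
import Mathlib

section
/- For every 1 ≤ K < M, the Partial Effective Rank is nondecreasing in K: PER_{K+1} − PER_K ≥ 0. -/
/-- The Partial Effective Rank of a sequence of singular values `σ : Fin M → ℝ`,
truncated to the first `K` values: `PER_K = exp(H(p_{K,1}, …, p_{K,K}))` where
`p_{K,k} = σ k / (σ 0 + ⋯ + σ (K-1))` and `H` is the Shannon entropy with the
convention `0 * log 0 = 0` (note `Real.log 0 = 0` in Mathlib). -/
noncomputable def PER {M : ℕ} (σ : Fin M → ℝ) (K : ℕ) (h : K ≤ M) : ℝ :=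
  Real.exp (-∑ k : Fin K,
    (σ (Fin.castLE h k) / ∑ j : Fin K, σ (Fin.castLE h j)) *
      Real.log (σ (Fin.castLE h k) / ∑ j : Fin K, σ (Fin.castLE h j)))

theorem neg_sum_div_mul_log_div {ι : Type*} [Fintype ι] (a : ι → ℝ) (hS : ∑ i, a i ≠ 0) :
    -∑ i, a i / (∑ j, a j) * Real.log (a i / ∑ j, a j) =
      Real.log (∑ i, a i) - (∑ i, a i * Real.log (a i)) / ∑ i, a i := by
  set S := ∑ i, a i with hSdef
  have key (i : ι) : a i / S * Real.log (a i / S) =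
      a i * Real.log (a i) / S - a i * (Real.log S / S) := by
    rcases eq_or_ne (a i) 0 with h | h
    · simp [h]
    · rw [Real.log_div h hS]
      ring
  simp_rw [key]
  rw [Finset.sum_sub_distrib, ← Finset.sum_div, ← Finset.sum_mul, ← hSdef]
  field_simp
  ring

theorem log_sub_div_le_of_forall_le {ι : Type*} [Fintype ι] (a : ι → ℝ) {x : ℝ}
    (hS : 0 < ∑ i, a i) (hx : 0 ≤ x) (hxa : ∀ i, x ≤ a i) :
    Real.log (∑ i, a i) - (∑ i, a i * Real.log (a i)) / ∑ i, a i ≤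
      Real.log (∑ i, a i + x) -
        (∑ i, a i * Real.log (a i) + x * Real.log x) / (∑ i, a i + x) := by
  rcases hx.eq_or_lt with rfl | hx
  · simp
  have hT : (∑ i, a i) * Real.log x ≤ ∑ i, a i * Real.log (a i) := by
    rw [Finset.sum_mul]
    gcongr with i
    · exact hx.le.trans (hxa i)
    · exact hxa i
  refine sub_le_sub (Real.log_le_log hS (by linarith)) ?_
  rw [div_le_div_iff₀ (by positivity) hS]
  linarith [mul_le_mul_of_nonneg_left hT hx.le]

/-- For every `1 ≤ K < M`, the Partial Effective Rank is nondecreasing in `K`: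
`PER_{K+1} − PER_K ≥ 0`. -/
theorem per_increment_nonneg {M : ℕ} (σ : Fin M → ℝ) (hmono : Antitone σ)
    (hnonneg : ∀ i, 0 ≤ σ i) (hM : 0 < M) (hpos : 0 < σ ⟨0, hM⟩)
    (K : ℕ) (hK1 : 1 ≤ K) (hKM : K < M) :
    0 ≤ PER σ (K + 1) hKM - PER σ K (le_of_lt hKM) := by
  have hfirst : 0 < ∑ k : Fin K, σ (Fin.castLE hKM.le k) :=
    Finset.sum_pos' (fun _ _ => hnonneg _) ⟨⟨0, hK1⟩, Finset.mem_univ _, hpos⟩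
  have hlast : 0 ≤ σ ⟨K, hKM⟩ := hnonneg _
  have hsum (f : ℝ → ℝ) : ∑ k : Fin (K + 1), f (σ (Fin.castLE hKM k)) =
      ∑ k : Fin K, f (σ (Fin.castLE hKM.le k)) + f (σ ⟨K, hKM⟩) :=
    Fin.sum_univ_castSucc _
  have hS := hsum id
  have hT := hsum fun y => y * Real.log y
  simp only [id] at hS
  rw [sub_nonneg, PER, PER, Real.exp_le_exp, neg_sum_div_mul_log_div _ hfirst.ne',
    neg_sum_div_mul_log_div _ (by rw [hS]; positivity), hS, hT]
  exact log_sub_div_le_of_forall_le _ hfirst hlast fun k => hmono k.isLt.le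
end

section
/- For every 1 ≤ K < M, the increment of the Partial Effective Rank is at most one: PER_{K+1} − PER_K ≤ 1. -/
open Real in
theorem mul_add_negMulLog_le {r c : ℝ} (a : ℝ) (hr : 0 ≤ r) (hc : 0 < c) :
    r * a + negMulLog r ≤ r * log c + exp a / c - r := by
  rcases hr.eq_or_lt with rfl | hr
  · simp only [zero_mul, negMulLog_zero, sub_zero, zero_add]
    positivity
  · have h := log_le_sub_one_of_pos (show 0 < exp a / (r * c) by positivity)
    rw [log_div (by positivity) (by positivity), log_mul hr.ne' hc.ne', log_exp] at h
    have h' := mul_le_mul_of_nonneg_left h hr.le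
    have e : r * (exp a / (r * c) - 1) = exp a / c - r := by field_simp
    rw [e] at h'
    unfold negMulLog
    linarith

open Real in
/-- Gibbs variational inequality for a two-point mixture. -/
theorem exp_mul_add_negMulLog_le {p q : ℝ} (a : ℝ) (hp : 0 ≤ p) (hq : 0 ≤ q)
    (hpq : p + q = 1) :
    exp (p * a + negMulLog p + negMulLog q) ≤ exp a + 1 := by
  have hc : 0 < exp a + 1 := by positivity
  rw [← le_log_iff_exp_le hc]
  have h₁ := mul_add_negMulLog_le a hp hc
  have h₂ := mul_add_negMulLog_le 0 hq hc
  have e : exp a / (exp a + 1) + exp 0 / (exp a + 1) = 1 := by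
    rw [exp_zero]
    field_simp
  have e' : p * log (exp a + 1) + q * log (exp a + 1) = log (exp a + 1) := by
    rw [← add_mul, hpq, one_mul]
  linarith

open Real in
theorem PER_eq_exp_sum_negMulLog {M : ℕ} (σ : Fin M → ℝ) (K : ℕ) (h : K ≤ M) :
    PER σ K h = exp (∑ k : Fin K,
      negMulLog (σ (Fin.castLE h k) / ∑ j : Fin K, σ (Fin.castLE h j))) := by
  simp [PER, negMulLog, Finset.sum_neg_distrib]

open Real in
/-- The chain rule for entropy when the last point is split off. -/
theorem sum_negMulLog_div_add {ι : Type*} [Fintype ι] (x : ι → ℝ) (s : ℝ)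
    (hS : ∑ i, x i ≠ 0) :
    ∑ i, negMulLog (x i / (∑ j, x j + s)) =
      (∑ j, x j) / (∑ j, x j + s) * ∑ i, negMulLog (x i / ∑ j, x j) +
        negMulLog ((∑ j, x j) / (∑ j, x j + s)) := by
  set S := ∑ j, x j
  have hx (i : ι) : x i / (S + s) = x i / S * (S / (S + s)) := by field_simp
  simp_rw [hx, negMulLog_mul, Finset.sum_add_distrib, ← Finset.mul_sum, ← Finset.sum_mul,
    ← Finset.sum_div]
  rw [show (∑ j, x j) / S = 1 from div_self hS, one_mul]

/-- For every `1 ≤ K < M`, the increment of the Partial Effective Rank is at most one: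
`PER_{K+1} − PER_K ≤ 1`. -/
theorem per_increment_le_one {M : ℕ} (σ : Fin M → ℝ) (hmono : Antitone σ)
    (hnonneg : ∀ i, 0 ≤ σ i) (hM : 0 < M) (hpos : 0 < σ ⟨0, hM⟩)
    (K : ℕ) (hK1 : 1 ≤ K) (hKM : K < M) :
    PER σ (K + 1) hKM - PER σ K (le_of_lt hKM) ≤ 1 := by
  have hS : 0 < ∑ j : Fin K, σ (Fin.castLE hKM.le j) :=
    Finset.sum_pos' (fun _ _ => hnonneg _) ⟨⟨0, hK1⟩, Finset.mem_univ _, hpos⟩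
  have hs : 0 ≤ σ ⟨K, hKM⟩ := hnonneg _
  have hcast (j : Fin K) : Fin.castLE (Nat.succ_le_of_lt hKM) j.castSucc =
      Fin.castLE hKM.le j := rfl
  have hlast : Fin.castLE (Nat.succ_le_of_lt hKM) (Fin.last K) = ⟨K, hKM⟩ := rfl
  rw [sub_le_iff_le_add, PER_eq_exp_sum_negMulLog, PER_eq_exp_sum_negMulLog]
  simp only [Fin.sum_univ_castSucc, hcast, hlast]
  rw [sum_negMulLog_div_add _ _ hS.ne', add_comm 1]
  refine exp_mul_add_negMulLog_le _ (by positivity) (by positivity) ?_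
  rw [← add_div, div_self (by positivity)]
end

section
/- ESPRIT identifiability: suppose the nodes z_1, …, z_K are pairwise distinct, K ≤ M, A is an invertible K×K complex matrix, and W = V · A. If a K×K complex matrix X satisfies W↑ · X = W↓, then X = A⁻¹ · diag(z_1, …, z_K) · A; in particular X is similar to diag(z_1, …, z_K), so the set of eigenvalues of X is exactly {z_1, …, z_K}. -/
open Matrix

/-- The first `K` rows of a tall Vandermonde matrix with distinct nodes are invertible, so the
matrix is left cancellable. -/
theorem vandermonde_rows_mul_left_cancel {R : Type*} [CommRing R] [IsDomain R] {K M : ℕ}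
    {n : Type*} {z : Fin K → R} (hz : Function.Injective z) (hKM : K ≤ M)
    {B C : Matrix (Fin K) n R}
    (h : (of fun (m : Fin M) k => z k ^ (m : ℕ)) * B =
      (of fun (m : Fin M) k => z k ^ (m : ℕ)) * C) :
    B = C := by
  ext i j
  have hcol : (fun k => B k j - C k j) = 0 := by
    refine eq_zero_of_mulVec_eq_zero (M := (vandermonde z)ᵀ)
      (by rw [det_transpose]; exact det_vandermonde_ne_zero_iff.mpr hz) ?_
    ext m
    have hm := congrFun₂ h (Fin.castLE hKM m) j
    simp only [mul_apply, of_apply, Fin.val_castLE] at hm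
    simp [mulVec, dotProduct, vandermonde_apply, mul_sub, hm]
  exact sub_eq_zero.mp (congrFun hcol i)

/-- ESPRIT identifiability: let `V m k = (z k) ^ m` be the `(M+1) × K` Vandermonde
matrix with pairwise distinct nodes `z`, `K ≤ M`, let `A` be an invertible `K × K`
matrix and `W = V * A`. If a `K × K` matrix `X` satisfies `W↑ * X = W↓` (where `B↑`
deletes the last row and `B↓` deletes the first row), then
`X = A⁻¹ * diag z * A`; in particular `X` is similar to `diag z`, so the set of
eigenvalues (spectrum) of `X` is exactly `{z 1, …, z K}`. -/
theorem esprit_identifiability {K M : ℕ} (hM : 1 ≤ M)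
    (z : Fin K → ℂ) (hzinj : Function.Injective z) (hKM : K ≤ M)
    (V : Matrix (Fin (M + 1)) (Fin K) ℂ)
    (hV : ∀ (m : Fin (M + 1)) (k : Fin K), V m k = z k ^ (m : ℕ))
    (A : Matrix (Fin K) (Fin K) ℂ) (hA : IsUnit A)
    (W : Matrix (Fin (M + 1)) (Fin K) ℂ) (hW : W = V * A)
    (X : Matrix (Fin K) (Fin K) ℂ)
    (hX : W.submatrix (Fin.castSucc : Fin M → Fin (M + 1)) id * X =
      W.submatrix (Fin.succ : Fin M → Fin (M + 1)) id) :
    X = A⁻¹ * Matrix.diagonal z * A ∧ spectrum ℂ X = Set.range z := by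
  subst hW
  have hdet : IsUnit A.det := (isUnit_iff_isUnit_det A).mp hA
  have hup : V.submatrix (Fin.castSucc : Fin M → Fin (M + 1)) id =
      of fun (m : Fin M) k => z k ^ (m : ℕ) := by
    ext m k
    simp [hV]
  have hdown : V.submatrix (Fin.succ : Fin M → Fin (M + 1)) id =
      (of fun (m : Fin M) k => z k ^ (m : ℕ)) * diagonal z := by
    ext m k
    simp [hV, pow_succ]
  have hAX : A * X = diagonal z * A := by
    refine vandermonde_rows_mul_left_cancel hzinj hKM ?_
    rw [submatrix_mul V A _ id id Function.bijective_id,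
      submatrix_mul V A _ id id Function.bijective_id, hup, hdown, submatrix_id_id] at hX
    simpa only [Matrix.mul_assoc] using hX
  have hXA : X = A⁻¹ * diagonal z * A := by
    rw [Matrix.mul_assoc, ← hAX, nonsing_inv_mul_cancel_left A X hdet]
  refine ⟨hXA, ?_⟩
  obtain ⟨U, rfl⟩ := hA
  rw [hXA, ← coe_units_inv, spectrum.units_conjugate', spectrum_diagonal]
end

section
/- Three-term recurrence (tridiagonality) in the Lanczos process: let A be an n×n Hermitian complex matrix (Aᴴ = A), let f ∈ ℂⁿ, and suppose q_0, …, q_K are orthonormal vectors in the Euclidean space ℂⁿ such that for every j ≤ K, the span of {q_0, …, q_j} equals the span of the Krylov vectors {f, A·f, …, Aʲ·f}. Then ⟪q_i, A·q_j⟫ = 0 for all i, j ≤ K with |i − j| ≥ 2; equivalently, the matrix with entries Γ_{i,j} = ⟪q_i, A·q_j⟫ is tridiagonal. -/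
open Matrix
open scoped InnerProductSpace

theorem Matrix.toEuclideanLin_mem_span_krylov {n : ℕ} (A : Matrix (Fin n) (Fin n) ℂ)
    (f : EuclideanSpace ℂ (Fin n)) {m : ℕ} {v : EuclideanSpace ℂ (Fin n)}
    (hv : v ∈ Submodule.span ℂ
      ((fun l : ℕ => WithLp.toLp 2 ((A ^ l).mulVec (WithLp.ofLp f))) '' {l : ℕ | l ≤ m})) :
    Matrix.toEuclideanLin A v ∈ Submodule.span ℂ
      ((fun l : ℕ => WithLp.toLp 2 ((A ^ l).mulVec (WithLp.ofLp f))) '' {l : ℕ | l ≤ m + 1}) := by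
  rw [← Submodule.mem_comap]
  refine Submodule.span_le.2 ?_ hv
  rintro _ ⟨l, hl, rfl⟩
  refine Submodule.subset_span ⟨l + 1, Nat.succ_le_succ hl, ?_⟩
  simp [Matrix.toLpLin_apply, pow_succ', Matrix.mulVec_mulVec]

theorem Orthonormal.inner_eq_zero_of_mem_span_image {ι E : Type*} [NormedAddCommGroup E]
    [InnerProductSpace ℂ E] {q : ι → E} (hq : Orthonormal ℂ q) {s : Set ι} {i : ι} (hi : i ∉ s)
    {v : E} (hv : v ∈ Submodule.span ℂ (q '' s)) : ⟪q i, v⟫_ℂ = 0 := by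
  rw [← Submodule.mem_orthogonal_singleton_iff_inner_right]
  refine Submodule.span_le.2 ?_ hv
  rintro _ ⟨k, hk, rfl⟩
  exact Submodule.mem_orthogonal_singleton_iff_inner_right.2
    (hq.inner_eq_zero fun h => hi (h ▸ hk))

/-- Three-term recurrence (tridiagonality) in the Lanczos process: let `A` be an `n × n`
Hermitian complex matrix (`Aᴴ = A`), let `f ∈ ℂⁿ`, and suppose `q 0, …, q K` are
orthonormal vectors in the Euclidean space `ℂⁿ` such that for every `j ≤ K` the span of
`{q 0, …, q j}` equals the span of the Krylov vectors `{f, A·f, …, Aʲ·f}`. Then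
`⟪q i, A·(q j)⟫ = 0` whenever `|i − j| ≥ 2`; i.e. the matrix `Γ i j = ⟪q i, A·(q j)⟫`
is tridiagonal. -/
theorem lanczos_three_term_recurrence {n K : ℕ}
    (A : Matrix (Fin n) (Fin n) ℂ) (hA : Aᴴ = A)
    (f : EuclideanSpace ℂ (Fin n))
    (q : Fin (K + 1) → EuclideanSpace ℂ (Fin n))
    (hq : Orthonormal ℂ q)
    (hspan : ∀ j : Fin (K + 1),
      Submodule.span ℂ (q '' {i : Fin (K + 1) | i ≤ j}) =
        Submodule.span ℂ
          ((fun l : ℕ => (WithLp.equiv 2 (Fin n → ℂ)).symm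
              ((A ^ l).mulVec (WithLp.equiv 2 (Fin n → ℂ) f))) ''
            {l : ℕ | l ≤ (j : ℕ)})) :
    ∀ i j : Fin (K + 1), (i : ℕ) + 2 ≤ (j : ℕ) ∨ (j : ℕ) + 2 ≤ (i : ℕ) →
      ⟪q i, (WithLp.equiv 2 (Fin n → ℂ)).symm
          (A.mulVec (WithLp.equiv 2 (Fin n → ℂ) (q j)))⟫_ℂ = 0 := by
  have upper : ∀ i j : Fin (K + 1), (j : ℕ) + 2 ≤ (i : ℕ) →
      ⟪q i, Matrix.toEuclideanLin A (q j)⟫_ℂ = 0 := by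
    intro i j hij
    have hj : q j ∈ Submodule.span ℂ (q '' {k : Fin (K + 1) | k ≤ j}) :=
      Submodule.subset_span ⟨j, le_refl j, rfl⟩
    rw [hspan j] at hj
    have hmem := Matrix.toEuclideanLin_mem_span_krylov A f hj
    have hlt : (j : ℕ) + 1 < K + 1 := by omega
    refine hq.inner_eq_zero_of_mem_span_image (s := {k | k ≤ ⟨(j : ℕ) + 1, hlt⟩}) ?_ ?_
    · simp only [Set.mem_ofPred_eq, Fin.le_def]
      omega
    · rw [hspan ⟨(j : ℕ) + 1, hlt⟩]
      exact hmem
  have hsymm : (Matrix.toEuclideanLin A).IsSymmetric :=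
    Matrix.isSymmetric_toEuclideanLin_iff.2 hA
  intro i j hij
  change ⟪q i, Matrix.toEuclideanLin A (q j)⟫_ℂ = 0
  rcases hij with h | h
  · rw [← hsymm, inner_eq_zero_symm]
    exact upper j i h
  · exact upper i j h
end

section
/- Sampling theorem for uniform DFT pilots: let N = 2MD + 1 with M ≥ 1 and D ≥ 1, and let x : ZMod N → ℂ be supported on the set {0, 1, …, L−1} (viewed in ZMod N) where L·D ≤ N. If the discrete Fourier transform x̂ of x vanishes at every pilot frequency, i.e., x̂(kD) = 0 for every integer k with −M ≤ k ≤ M (indices taken in ZMod N), then x = 0. Equivalently, a signal supported on L ≤ ⌊N/D⌋ consecutive time indices is uniquely determined by its DFT values at the 2M+1 pilot bins {−MD, …, −D, 0, D, …, MD}. -/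
/-- The DFT kernel expressed through the standard additive character of `ZMod N`. -/
lemma exp_eq_stdAddChar_neg_mul {N : ℕ} [NeZero N] (a n : ZMod N) :
    Complex.exp (-2 * Real.pi * Complex.I * ((a.val : ℂ) * (n.val : ℂ)) / (N : ℂ)) =
      ZMod.stdAddChar (-(a * n)) := by
  have h : -(a * n) = ((-((a.val : ℤ) * (n.val : ℤ)) : ℤ) : ZMod N) := by
    push_cast
    rw [ZMod.natCast_zmod_val, ZMod.natCast_zmod_val]
  rw [h, ZMod.stdAddChar_coe]
  congr 1
  push_cast
  ring

/-- `D` is cancellable modulo `2 * M * D + 1`, since `2 * M * D = -1` there. -/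
lemma mul_left_injective_zmod_two_mul_mul_add_one (M D : ℕ) :
    Function.Injective fun n : ZMod (2 * M * D + 1) => (D : ZMod (2 * M * D + 1)) * n := by
  have hN : (2 * M * D + 1 : ZMod (2 * M * D + 1)) = 0 := by
    exact_mod_cast ZMod.natCast_self (2 * M * D + 1)
  intro a b hab
  linear_combination (-(2 * M : ZMod (2 * M * D + 1))) * hab + (a - b) * hN

/-- Sampling theorem for uniform DFT pilots: let `N = 2*M*D + 1` with `M ≥ 1`, `D ≥ 1`,
and let `x : ZMod N → ℂ` be supported on `{0, 1, …, L−1}` (viewed in `ZMod N`) where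
`L * D ≤ N`. If the discrete Fourier transform
`x̂ m = ∑ n, x n * exp(−2πi·m·n/N)` vanishes at every pilot frequency `k*D (mod N)` for
every integer `−M ≤ k ≤ M`, then `x = 0`: a signal supported on at most `⌊N/D⌋`
consecutive time indices is uniquely determined by its DFT values at the `2M+1` pilot
bins `{−MD, …, −D, 0, D, …, MD}`. -/
theorem dft_uniform_pilot_sampling {M D L : ℕ} (hM : 1 ≤ M) (hD : 1 ≤ D)
    (hL : L * D ≤ 2 * M * D + 1)
    (x : ZMod (2 * M * D + 1) → ℂ)
    (hsupp : ∀ n : ZMod (2 * M * D + 1), x n ≠ 0 → n.val < L)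
    (hpilot : ∀ k : ℤ, -(M : ℤ) ≤ k → k ≤ (M : ℤ) →
      ∑ n : ZMod (2 * M * D + 1),
        x n * Complex.exp (-2 * Real.pi * Complex.I *
          ((((k * (D : ℤ) : ℤ) : ZMod (2 * M * D + 1)).val : ℂ) * (n.val : ℂ)) /
            ((2 * M * D + 1 : ℕ) : ℂ)) = 0) :
    x = 0 := by
  have hL' : L ≤ 2 * M + 1 := by nlinarith
  have hLN : L ≤ 2 * M * D + 1 := by nlinarith
  let c : Fin L → ZMod (2 * M * D + 1) := fun j => ((j : ℕ) : ZMod (2 * M * D + 1))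
  have hval (j : Fin L) : (c j).val = j := ZMod.val_natCast_of_lt (j.2.trans_le hLN)
  have hc : Function.Injective c := fun i j hij => Fin.ext <| by rw [← hval, hij, hval]
  let f : Fin L → ℂ := fun j => ZMod.stdAddChar (-((D : ZMod (2 * M * D + 1)) * c j))
  have hf : Function.Injective f := fun i j hij =>
    hc <| mul_left_injective_zmod_two_mul_mul_add_one M D <|
      neg_injective <| ZMod.injective_stdAddChar hij
  let v : Fin L → ℂ := fun j => x (c j) * ZMod.stdAddChar ((M * D : ZMod (2 * M * D + 1)) * c j)
  have hv : v = 0 := by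
    refine Matrix.eq_zero_of_forall_pow_sum_mul_pow_eq_zero hf fun i => ?_
    rw [← hpilot ((i : ℤ) - M) (by omega) (by omega)]
    refine Fintype.sum_of_injective c hc _ _ (fun n hn => ?_) fun j => ?_
    · have hx : x n = 0 := by
        by_contra hx
        exact hn ⟨⟨n.val, hsupp n hx⟩, ZMod.natCast_zmod_val n⟩
      rw [hx, zero_mul]
    · rw [exp_eq_stdAddChar_neg_mul]
      simp only [v, f]
      rw [mul_assoc, ← AddChar.map_nsmul_eq_pow, ← AddChar.map_add_eq_mul]
      congr 2
      push_cast
      rw [nsmul_eq_mul]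
      ring
  funext n
  by_contra hx
  have hn : c ⟨n.val, hsupp n hx⟩ = n := ZMod.natCast_zmod_val n
  have h := congrFun hv ⟨n.val, hsupp n hx⟩
  simp only [v, hn, Pi.zero_apply, mul_eq_zero] at h
  exact h.elim hx ((AddChar.val_isUnit (ZMod.stdAddChar (N := 2 * M * D + 1)) _).ne_zero)
end
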